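/- Let $\mu$ be a locally finite Borel measure on $\mathbb{R}^d$, $p\in(1,\infty)$, and $b\in L^1_{loc}(\mu)$. If the dyadic paraproduct $P_{b,\mathcal{D}}:L^p(\mu)\to L^p(\mu)$ is compact, then $b$ has vanishing mean oscillation along heavy cubes: $\lim_{M\to\infty}\sup\{\|b-\langle b\rangle_Q\|_{\avL^p(Q)} : Q\in\mathcal{D},\ \mu(Q)\ge M\} = 0$, where $\|b-\langle b\rangle_Q\|_{\avL^p(Q)} := (\frac{1}{\mu(Q)}\int_Q|b-\langle b\rangle_Q|^p d\mu)^{1/p}$. -/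

import Mathlib

open MeasureTheory Filter
open scoped ENNReal

noncomputable section
open scoped Classical

/-- The standard dyadic cube of generation `k` and position `m` in `ℝ^d`,
of side length `2^{-k}`. -/
def dCube (d : ℕ) (k : ℤ) (m : Fin d → ℤ) : Set (Fin d → ℝ) :=
  {x | ∀ j, (m j : ℝ) * (2 : ℝ) ^ (-k) ≤ x j ∧ x j < ((m j : ℝ) + 1) * (2 : ℝ) ^ (-k)}

/-- The average `⟨b⟩_Q` of `b` over `Q` with respect to `μ`. -/
def avg {d : ℕ} (μ : Measure (Fin d → ℝ)) (b : (Fin d → ℝ) → ℝ)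
    (Q : Set (Fin d → ℝ)) : ℝ :=
  (μ Q).toReal⁻¹ * ∫ x in Q, b x ∂μ

/-- The dyadic cube of generation `k` containing the point `x`. -/
def cubeOf (d : ℕ) (k : ℤ) (x : Fin d → ℝ) : Set (Fin d → ℝ) :=
  dCube d k fun j => ⌊x j * (2 : ℝ) ^ k⌋

/-- The martingale difference `D_Q b` over the dyadic cube `Q = dCube d k m`:
on each dyadic child it equals the child's average minus the average over `Q`. -/
def Dmd {d : ℕ} (μ : Measure (Fin d → ℝ)) (b : (Fin d → ℝ) → ℝ) (k : ℤ)
    (m : Fin d → ℤ) : (Fin d → ℝ) → ℝ := fun x =>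
  if x ∈ dCube d k m then avg μ b (cubeOf d (k + 1) x) - avg μ b (dCube d k m) else 0

/-- The dyadic paraproduct `P_{b,𝒟} f = ∑_{Q ∈ 𝒟} D_Q b ⟨f⟩_Q 1_Q`. -/
def paraproduct {d : ℕ} (μ : Measure (Fin d → ℝ)) (b f : (Fin d → ℝ) → ℝ) :
    (Fin d → ℝ) → ℝ := fun x =>
  ∑' q : ℤ × (Fin d → ℤ), Dmd μ b q.1 q.2 x * avg μ f (dCube d q.1 q.2)


/-- The integer position of the dyadic cube of generation `k` containing `x`. -/
def fl {d : ℕ} (k : ℤ) (x : Fin d → ℝ) : Fin d → ℤ := fun j => ⌊x j * (2 : ℝ) ^ k⌋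

lemma mem_dCube {d : ℕ} {k : ℤ} {m : Fin d → ℤ} {x : Fin d → ℝ} :
    x ∈ dCube d k m ↔ fl k x = m := by
  have h2 : (0 : ℝ) < 2 ^ k := by positivity
  simp only [dCube, Set.mem_ofPred_eq, fl, funext_iff, Int.floor_eq_iff, zpow_neg]
  refine forall_congr' fun j => ?_
  rw [← div_eq_mul_inv, ← div_eq_mul_inv, div_le_iff₀ h2, lt_div_iff₀ h2]

lemma mem_cubeOf {d : ℕ} {k : ℤ} {x y : Fin d → ℝ} :
    y ∈ cubeOf d k x ↔ fl k y = fl k x := mem_dCube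

lemma cubeOf_eq {d : ℕ} (k : ℤ) (x : Fin d → ℝ) : cubeOf d k x = dCube d k (fl k x) := rfl

lemma self_mem_cubeOf {d : ℕ} (k : ℤ) (x : Fin d → ℝ) : x ∈ cubeOf d k x := mem_cubeOf.2 rfl

lemma fl_pred {d : ℕ} (k : ℤ) (x : Fin d → ℝ) : fl k x = fun j => fl (k + 1) x j / 2 := by
  funext j
  have := Int.floor_div_natCast (x j * (2 : ℝ) ^ (k + 1)) 2
  simp only [fl]
  push_cast at this
  rw [← this, zpow_add_one₀ (by norm_num)]
  congr 1
  ring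

lemma fl_mono {d : ℕ} {k l : ℤ} (h : k ≤ l) {x y : Fin d → ℝ} (hxy : fl l x = fl l y) :
    fl k x = fl k y := by
  obtain ⟨n, rfl⟩ := Int.le.dest h
  induction n with
  | zero => simpa using hxy
  | succ n ih =>
    apply ih (by omega)
    rw [fl_pred _ x, fl_pred _ y]
    push_cast at hxy
    rw [← add_assoc] at hxy
    rw [hxy]

lemma cubeOf_anti {d : ℕ} {k l : ℤ} (h : k ≤ l) (x : Fin d → ℝ) :
    cubeOf d l x ⊆ cubeOf d k x := fun _ hy => mem_cubeOf.2 (fl_mono h (mem_cubeOf.1 hy))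

lemma measurable_fl {d : ℕ} (k : ℤ) : Measurable (fl (d := d) k) := by
  refine measurable_pi_lambda _ fun j => ?_
  exact Int.measurable_floor.comp ((measurable_pi_apply j).mul_const _)

lemma dCube_eq_preimage {d : ℕ} (k : ℤ) (m : Fin d → ℤ) : dCube d k m = fl k ⁻¹' {m} := by
  ext x; exact mem_dCube

lemma measurableSet_dCube {d : ℕ} (k : ℤ) (m : Fin d → ℤ) : MeasurableSet (dCube d k m) := by
  rw [dCube_eq_preimage]; exact measurable_fl k (measurableSet_singleton _)

lemma measure_dCube_ne_top {d : ℕ} (μ : Measure (Fin d → ℝ)) [IsLocallyFiniteMeasure μ]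
    (k : ℤ) (m : Fin d → ℤ) : μ (dCube d k m) ≠ ⊤ := by
  have hsub : dCube d k m ⊆ Set.Icc (fun j => (m j : ℝ) * (2 : ℝ) ^ (-k))
      (fun j => ((m j : ℝ) + 1) * (2 : ℝ) ^ (-k)) :=
    fun x hx => ⟨fun j => (hx j).1, fun j => (hx j).2.le⟩
  exact ((measure_mono hsub).trans_lt isCompact_Icc.measure_lt_top).ne

lemma ae_cube_pos {d : ℕ} (μ : Measure (Fin d → ℝ)) :
    ∀ᵐ x ∂μ, ∀ k : ℤ, μ (cubeOf d k x) ≠ 0 := by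
  rw [ae_all_iff]
  intro k
  have : ∀ m : Fin d → ℤ, ∀ᵐ x ∂μ, μ (dCube d k m) = 0 → x ∉ dCube d k m := by
    intro m
    by_cases h : μ (dCube d k m) = 0
    · filter_upwards [measure_eq_zero_iff_ae_notMem.1 h] with x hx _ using hx
    · exact Eventually.of_forall fun x h' => absurd h' h
  filter_upwards [ae_all_iff.2 this] with x hx h0
  exact hx (fl k x) h0 (self_mem_cubeOf k x)

lemma avg_congr_ae {d : ℕ} {μ : Measure (Fin d → ℝ)} {f g : (Fin d → ℝ) → ℝ} (h : f =ᵐ[μ] g)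
    (Q : Set (Fin d → ℝ)) : avg μ f Q = avg μ g Q := by
  unfold avg
  rw [integral_congr_ae (ae_restrict_of_ae h)]

lemma paraproduct_congr_ae {d : ℕ} {μ : Measure (Fin d → ℝ)} {b f g : (Fin d → ℝ) → ℝ}
    (h : f =ᵐ[μ] g) : paraproduct μ b f = paraproduct μ b g := by
  unfold paraproduct
  simp only [avg_congr_ae h]

/-- The martingale increment at `x`. -/
def dk {d : ℕ} (μ : Measure (Fin d → ℝ)) (b : (Fin d → ℝ) → ℝ) (k : ℤ) (x : Fin d → ℝ) : ℝ :=
  avg μ b (cubeOf d (k + 1) x) - avg μ b (cubeOf d k x)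

lemma emb_injective {d : ℕ} (x : Fin d → ℝ) :
    Function.Injective (fun k : ℤ => ((k, fl k x) : ℤ × (Fin d → ℤ))) := by
  intro k l h
  exact (Prod.ext_iff.1 h).1

lemma Dmd_fl {d : ℕ} (μ : Measure (Fin d → ℝ)) (b : (Fin d → ℝ) → ℝ) (k : ℤ) (x : Fin d → ℝ) :
    Dmd μ b k (fl k x) x = dk μ b k x := by
  unfold Dmd dk
  rw [if_pos (mem_dCube.2 rfl)]; rfl

lemma paraproduct_eq {d : ℕ} (μ : Measure (Fin d → ℝ)) (b f : (Fin d → ℝ) → ℝ)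
    (x : Fin d → ℝ) :
    paraproduct μ b f x = ∑' k : ℤ, dk μ b k x * avg μ f (cubeOf d k x) := by
  unfold paraproduct
  rw [← (emb_injective x).tsum_eq]
  · simp only [Dmd_fl]; rfl
  · intro q hq
    by_contra hn
    apply hq
    have : x ∉ dCube d q.1 q.2 := by
      intro hx
      exact hn ⟨q.1, Prod.ext rfl (mem_dCube.1 hx)⟩
    simp [Dmd, this]

/-- increments vanish when the measure does not drop -/
lemma dk_eq_zero {d : ℕ} {μ : Measure (Fin d → ℝ)} [IsLocallyFiniteMeasure μ]
    {b : (Fin d → ℝ) → ℝ} {k : ℤ} {x : Fin d → ℝ}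
    (h : μ (cubeOf d (k + 1) x) = μ (cubeOf d k x)) : dk μ b k x = 0 := by
  have hae : cubeOf d (k + 1) x =ᵐ[μ] cubeOf d k x := by
    refine ae_eq_of_subset_of_measure_ge (cubeOf_anti (by omega) x) h.ge ?_ ?_
    · exact (measurableSet_dCube _ _).nullMeasurableSet
    · exact measure_dCube_ne_top μ _ _
  unfold dk avg
  rw [h, setIntegral_congr_set hae, sub_self]

lemma measurableSet_cubeOf {d : ℕ} (k : ℤ) (x : Fin d → ℝ) : MeasurableSet (cubeOf d k x) :=
  measurableSet_dCube _ _

lemma measure_cubeOf_ne_top {d : ℕ} (μ : Measure (Fin d → ℝ)) [IsLocallyFiniteMeasure μ]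
    (k : ℤ) (x : Fin d → ℝ) : μ (cubeOf d k x) ≠ ⊤ := measure_dCube_ne_top μ _ _

lemma avg_indicator {d : ℕ} (μ : Measure (Fin d → ℝ)) (k l : ℤ) (x : Fin d → ℝ) :
    avg μ ((cubeOf d l x).indicator fun _ => (1 : ℝ)) (cubeOf d k x) =
      (μ.real (cubeOf d k x))⁻¹ * μ.real (cubeOf d (max k l) x) := by
  unfold avg
  rw [integral_indicator_const _ (measurableSet_cubeOf _ _)]
  rw [measureReal_restrict_apply (measurableSet_cubeOf _ _)]
  rcases le_total k l with h | h
  · rw [max_eq_right h, Set.inter_eq_left.2 (cubeOf_anti h x)]; simp [Measure.real]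
  · rw [max_eq_left h, Set.inter_eq_right.2 (cubeOf_anti h x)]; simp [Measure.real]

/-- The dyadic filtration starting at generation `k`. -/
def dyadicFil (d : ℕ) (k : ℤ) : Filtration ℕ (MeasurableSpace.pi : MeasurableSpace (Fin d → ℝ)) where
  seq n := MeasurableSpace.comap (fl (k + n)) ⊤
  mono' := by
    intro n m hnm
    rintro s ⟨A, -, rfl⟩
    refine ⟨fl (k + m) '' (fl (k + n) ⁻¹' A), trivial, ?_⟩
    ext x
    simp only [Set.mem_preimage, Set.mem_image]
    constructor
    · rintro ⟨y, hy, hxy⟩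
      rwa [← fl_mono (by have : (n : ℤ) ≤ m := by exact_mod_cast hnm
                         omega) hxy]
    · intro hx
      exact ⟨x, hx, rfl⟩
  le' := by
    intro n
    have := (measurable_fl (d := d) (k + n)).comap_le
    rintro s ⟨A, -, rfl⟩
    exact measurable_fl (k + n) (MeasurableSet.of_discrete)

lemma iSup_dyadicFil (d : ℕ) (k : ℤ) :
    (⨆ n, dyadicFil d k n) = (MeasurableSpace.pi : MeasurableSpace (Fin d → ℝ)) := by
  apply le_antisymm (iSup_le fun n => (dyadicFil d k).le n)
  have hcoord : ∀ j : Fin d, Measurable[⨆ n, dyadicFil d k n] (fun x : Fin d → ℝ => x j) := by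
    intro j
    have hm : ∀ n : ℕ, Measurable[⨆ n, dyadicFil d k n]
        (fun x : Fin d → ℝ => (fl (k + n) x j : ℝ) / (2 : ℝ) ^ (k + n)) := by
      intro n
      have h1 : Measurable[dyadicFil d k n]
          (fun x : Fin d → ℝ => (fl (k + n) x j : ℝ) / (2 : ℝ) ^ (k + n)) := by
        intro s _
        exact ⟨(fun m : Fin d → ℤ => (m j : ℝ) / (2 : ℝ) ^ (k + n)) ⁻¹' s, trivial, rfl⟩
      exact h1.mono (le_iSup (fun n => (dyadicFil d k n)) n) le_rfl
    refine @measurable_of_tendsto_metrizable _ _ (⨆ n, dyadicFil d k n) _ _ _ _ _ _ hm ?_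
    rw [tendsto_pi_nhds]
    intro x
    have hlow : Tendsto (fun n : ℕ => x j - 1 / (2 : ℝ) ^ (k + (n : ℤ))) atTop (nhds (x j)) := by
      have : Tendsto (fun n : ℕ => (2 : ℝ) ^ (-k) * (1 / 2 : ℝ) ^ n) atTop (nhds 0) := by
        simpa using (tendsto_pow_atTop_nhds_zero_of_lt_one (r := (1 / 2 : ℝ))
          (by norm_num) (by norm_num)).const_mul ((2 : ℝ) ^ (-k))
      have h2 := this.const_sub (x j)
      rw [sub_zero] at h2
      refine h2.congr fun n => ?_
      rw [zpow_add₀ (by norm_num), zpow_neg, zpow_natCast, one_div, one_div, mul_inv, inv_pow]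
    refine tendsto_of_tendsto_of_tendsto_of_le_of_le hlow tendsto_const_nhds ?_ ?_
    · intro n
      have h2 : (0 : ℝ) < 2 ^ (k + (n : ℤ)) := by positivity
      have h3 := Int.lt_floor_add_one (x j * (2 : ℝ) ^ (k + (n : ℤ)))
      simp only [fl]
      rw [sub_le_iff_le_add, ← add_div, le_div_iff₀ h2]
      exact h3.le
    · intro n
      have h2 : (0 : ℝ) < 2 ^ (k + (n : ℤ)) := by positivity
      simp only [fl]
      rw [div_le_iff₀ h2]
      exact Int.floor_le _
  have hid : Measurable[⨆ n, dyadicFil d k n] (fun x : Fin d → ℝ => x) :=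
    @measurable_pi_lambda _ _ _ (⨆ n, dyadicFil d k n) _ _ hcoord
  intro s hs
  exact hid hs

lemma ae_tendsto_avg {d : ℕ} (μ : Measure (Fin d → ℝ)) [IsLocallyFiniteMeasure μ]
    {b : (Fin d → ℝ) → ℝ} (k : ℤ) (m : Fin d → ℤ) (hb : IntegrableOn b (dCube d k m) μ) :
    ∀ᵐ x ∂(μ.restrict (dCube d k m)),
      Tendsto (fun n : ℕ => avg μ b (cubeOf d (k + n) x)) atTop (nhds (b x)) := by
  set ν := μ.restrict (dCube d k m) with hν
  have : IsFiniteMeasure ν :=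
    ⟨by rw [hν, Measure.restrict_apply_univ]; exact (measure_dCube_ne_top μ k m).lt_top⟩
  have h1 := tendsto_ae_condExp (μ := ν) (ℱ := dyadicFil d k) b
  have h2 : ν[b | ⨆ n, dyadicFil d k n] =ᵐ[ν] b := by
    rw [iSup_dyadicFil]
    exact condExp_of_aestronglyMeasurable' le_rfl hb.aestronglyMeasurable hb
  have hpos : ∀ᵐ x ∂ν, ∀ k : ℤ, μ (cubeOf d k x) ≠ 0 := ae_restrict_of_ae (ae_cube_pos μ)
  have hmem : ∀ᵐ x ∂ν, x ∈ dCube d k m := ae_restrict_mem (measurableSet_dCube k m)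
  filter_upwards [h1, h2, hpos, hmem] with x hx1 hx2 hx3 hx4
  rw [hx2] at hx1
  refine hx1.congr fun n => ?_
  set h := ν[b | dyadicFil d k n] with hh
  have hsm : StronglyMeasurable[dyadicFil d k n] h := stronglyMeasurable_condExp
  have hconst : ∀ y ∈ cubeOf d (k + n) x, h y = h x := by
    intro y hy
    have hms : MeasurableSet[dyadicFil d k n] (h ⁻¹' {h x}) :=
      hsm.measurable (measurableSet_singleton _)
    obtain ⟨A, -, hA⟩ := hms
    have hxA : x ∈ fl (k + n) ⁻¹' A := by rw [hA]; rfl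
    have hyA : y ∈ fl (k + n) ⁻¹' A := by
      rw [Set.mem_preimage, mem_cubeOf.1 hy]; exact hxA
    rw [hA] at hyA
    exact hyA
  have hcm : MeasurableSet[dyadicFil d k n] (cubeOf d (k + n) x) :=
    ⟨{fl (k + n) x}, trivial, by rw [cubeOf_eq, dCube_eq_preimage]⟩
  have hint := setIntegral_condExp (μ := ν) ((dyadicFil d k).le n) hb hcm
  have hsub : cubeOf d (k + n) x ⊆ dCube d k m := by
    have := cubeOf_anti (k := k) (l := k + n) (by omega) x
    rwa [cubeOf_eq k, mem_dCube.1 hx4] at this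
  have hres : ν.restrict (cubeOf d (k + n) x) = μ.restrict (cubeOf d (k + n) x) := by
    rw [hν, Measure.restrict_restrict (measurableSet_cubeOf _ _), Set.inter_eq_left.2 hsub]
  rw [hres, setIntegral_congr_fun (g := fun _ => h x) (measurableSet_cubeOf _ _) hconst,
    setIntegral_const] at hint
  unfold avg
  rw [← hint, smul_eq_mul, ← mul_assoc]
  have : (μ (cubeOf d (k + n) x)).toReal ≠ 0 :=
    ENNReal.toReal_ne_zero.2 ⟨hx3 _, measure_cubeOf_ne_top μ _ _⟩
  rw [Measure.real, inv_mul_cancel₀ this, one_mul]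

lemma seq_summable (M dd lam : ℤ → ℝ) (hpos : ∀ k, 0 < M k) (hanti : Antitone M)
    (hd : ∀ k, M (k + 1) = M k → dd k = 0)
    (h1 : ∀ n, lam n = ∑' k, dd k * ((M k)⁻¹ * M (max k n)))
    (h2 : ∀ l m n, (M m - M n) * lam l + (M n - M l) * lam m + (M l - M m) * lam n =
      ∑' k, dd k * ((M m - M n) * ((M k)⁻¹ * M (max k l)) +
        (M n - M l) * ((M k)⁻¹ * M (max k m)) + (M l - M m) * ((M k)⁻¹ * M (max k n))))
    (n0 : ℤ) : Summable (fun k => dd k * ((M k)⁻¹ * M (max k n0))) := by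
  by_contra hns
  have hns' : ∀ n, ¬ Summable (fun k => dd k * ((M k)⁻¹ * M (max k n))) := by
    intro n hs
    apply hns
    refine Summable.of_norm_bounded (hs.norm.mul_left (1 + M n0 / M n)) ?_
    intro k
    have key : M (max k n0) ≤ (1 + M n0 / M n) * M (max k n) := by
      have hq : 0 < M n0 / M n := div_pos (hpos _) (hpos _)
      rcases le_total k n with h | h
      · rw [max_eq_right h]
        have : (1 + M n0 / M n) * M n = M n + M n0 := by
          field_simp [(hpos n).ne']
        rw [this]
        have := hanti (le_max_right k n0)
        linarith [hpos n]
      · rw [max_eq_left h]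
        have := hanti (le_max_left k n0)
        nlinarith [mul_pos hq (hpos k)]
    have hk := inv_pos.2 (hpos k)
    simp only [norm_mul, Real.norm_eq_abs, abs_of_pos hk, abs_of_pos (hpos (max k n0)),
      abs_of_pos (hpos (max k n))]
    calc |dd k| * ((M k)⁻¹ * M (max k n0))
        ≤ |dd k| * ((M k)⁻¹ * ((1 + M n0 / M n) * M (max k n))) := by gcongr
      _ = _ := by ring
  have hlam : ∀ n, lam n = 0 := fun n => by rw [h1, tsum_eq_zero_of_not_summable (hns' n)]
  have hex : ∃ i j, i < j ∧ dd i ≠ 0 ∧ dd j ≠ 0 := by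
    by_contra hno
    push Not at hno
    apply hns
    apply summable_of_hasFiniteSupport
    apply Set.Subsingleton.finite
    intro a ha c hc
    have ha' : dd a ≠ 0 := left_ne_zero_of_mul ha
    have hc' : dd c ≠ 0 := left_ne_zero_of_mul hc
    rcases lt_trichotomy a c with h | h | h
    · exact absurd (hno a c h ha') hc'
    · exact h
    · exact absurd (hno c a h hc') ha'
  obtain ⟨i0, j, hij0, hi0, hj⟩ := hex
  obtain ⟨i, ⟨hij, hi⟩, hmax⟩ := Int.exists_greatest_of_bdd (P := fun i => i < j ∧ dd i ≠ 0)
    ⟨j, fun z hz => hz.1.le⟩ ⟨i0, hij0, hi0⟩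
  have hMi : M (i + 1) < M i := lt_of_le_of_ne (hanti (by omega)) fun h => hi (hd i h)
  have hMj : M (j + 1) < M j := lt_of_le_of_ne (hanti (by omega)) fun h => hj (hd j h)
  have h := h2 i (i + 1) (j + 1)
  rw [hlam, hlam, hlam, tsum_eq_single j] at h
  · rw [max_eq_left (by omega : i ≤ j), max_eq_left (by omega : i + 1 ≤ j),
      max_eq_right (by omega : j ≤ j + 1)] at h
    have hMj0 := (hpos j).ne'
    have e : (M (i + 1) - M (j + 1)) * ((M j)⁻¹ * M j) + (M (j + 1) - M i) * ((M j)⁻¹ * M j) +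
        (M i - M (i + 1)) * ((M j)⁻¹ * M (j + 1)) =
        (M i - M (i + 1)) * (M (j + 1) - M j) * (M j)⁻¹ := by
      field_simp
      ring
    rw [e] at h
    have : dd j * ((M i - M (i + 1)) * (M (j + 1) - M j) * (M j)⁻¹) ≠ 0 :=
      mul_ne_zero hj (mul_ne_zero (mul_ne_zero (by linarith) (by linarith)) (inv_ne_zero hMj0))
    apply this
    rw [← h]; ring
  · intro k hk
    rcases lt_or_gt_of_ne hk with h | h
    · rcases le_or_gt k i with h' | h'
      · rw [max_eq_right h', max_eq_right (by omega), max_eq_right (by omega)]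
        ring
      · have : dd k = 0 := by
          by_contra hne
          have := hmax k ⟨h, hne⟩
          omega
        rw [this, zero_mul]
    · rw [max_eq_left (by omega), max_eq_left (by omega), max_eq_left (by omega)]
      ring

lemma seq_value (M be : ℤ → ℝ) (hpos : ∀ k, 0 < M k) (n0 : ℤ) (B : ℝ)
    (hs : Summable (fun k => (be (k + 1) - be k) * ((M k)⁻¹ * M (max k n0))))
    (hB : Tendsto (fun n : ℕ => be (n0 + n)) atTop (nhds B)) :
    ∑' k, (be (k + 1) - be k) * ((M k)⁻¹ * M (max k n0)) = B - be n0 +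
      ∑' n : ℕ, (be (n0 - n) - be (n0 - (n + 1))) * ((M (n0 - (n + 1)))⁻¹ * M n0) := by
  set F : ℤ → ℝ := fun k => (be (k + 1) - be k) * ((M k)⁻¹ * M (max k n0)) with hF
  have hs' : Summable (F ∘ (Equiv.addLeft n0)) := (Equiv.summable_iff _).2 hs
  have e1 : ∑' k, F k = ∑' k, F (n0 + k) := ((Equiv.addLeft n0).tsum_eq F).symm
  have hs1 : Summable (fun n : ℕ => F (n0 + n)) :=
    hs'.comp_injective (i := fun n : ℕ => (n : ℤ)) Nat.cast_injective
  have hs2 : Summable (fun n : ℕ => F (n0 + -((n : ℤ) + 1))) :=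
    hs'.comp_injective (i := fun n : ℕ => -((n : ℤ) + 1)) (by intro a c h; simpa using h)
  rw [e1, tsum_of_nat_of_neg_add_one (f := fun k => F (n0 + k)) hs1 hs2]
  congr 1
  · have h1 := hs1.hasSum.tendsto_sum_nat
    have h2 : Tendsto (fun n : ℕ => ∑ i ∈ Finset.range n, F (n0 + i)) atTop
        (nhds (B - be n0)) := by
      refine (hB.sub_const (be n0)).congr fun n => ?_
      have h3 := Finset.sum_range_sub (fun i : ℕ => be (n0 + i)) n
      simp only [Nat.cast_zero, add_zero] at h3
      rw [← h3]
      refine Finset.sum_congr rfl fun i _ => ?_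
      simp only [hF]
      rw [max_eq_left (by omega), inv_mul_cancel₀ (hpos _).ne', mul_one]
      push_cast
      rw [add_assoc]
    exact tendsto_nhds_unique h1 h2
  · refine tsum_congr fun n => ?_
    simp only [hF]
    rw [max_eq_right (by omega), show n0 + -((n : ℤ) + 1) + 1 = n0 - n by ring,
      show n0 + -((n : ℤ) + 1) = n0 - (n + 1) by ring]

/-- The indicator of a dyadic cube as an element of `L^p`. -/
def indLp {d : ℕ} (μ : Measure (Fin d → ℝ)) [IsLocallyFiniteMeasure μ] (p : ℝ≥0∞)
    (q : ℤ × (Fin d → ℤ)) : Lp ℝ p μ :=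
  indicatorConstLp p (measurableSet_dCube q.1 q.2) (measure_dCube_ne_top μ q.1 q.2) 1

lemma avg_comb {d : ℕ} (μ : Measure (Fin d → ℝ)) [IsLocallyFiniteMeasure μ] (A B C : ℝ)
    (q r s : ℤ × (Fin d → ℤ)) (S : Set (Fin d → ℝ)) :
    avg μ (fun y => A * (dCube d q.1 q.2).indicator (fun _ => (1 : ℝ)) y +
        B * (dCube d r.1 r.2).indicator (fun _ => (1 : ℝ)) y +
        C * (dCube d s.1 s.2).indicator (fun _ => (1 : ℝ)) y) S =
      A * avg μ ((dCube d q.1 q.2).indicator (fun _ => (1 : ℝ))) S +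
      B * avg μ ((dCube d r.1 r.2).indicator (fun _ => (1 : ℝ))) S +
      C * avg μ ((dCube d s.1 s.2).indicator (fun _ => (1 : ℝ))) S := by
  have hi : ∀ q : ℤ × (Fin d → ℤ),
      Integrable ((dCube d q.1 q.2).indicator (fun _ => (1 : ℝ))) (μ.restrict S) := by
    intro q
    refine Integrable.restrict ?_
    exact (integrable_indicator_iff (measurableSet_dCube _ _)).2
      (integrableOn_const (measure_dCube_ne_top μ _ _))
  unfold avg
  have hqr : Integrable (fun y => A * (dCube d q.1 q.2).indicator (fun _ => (1 : ℝ)) y +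
      B * (dCube d r.1 r.2).indicator (fun _ => (1 : ℝ)) y) (μ.restrict S) :=
    ((hi q).const_mul A).add ((hi r).const_mul B)
  beta_reduce
  rw [integral_add hqr ((hi s).const_mul C),
    integral_add ((hi q).const_mul A) ((hi r).const_mul B), integral_const_mul,
    integral_const_mul, integral_const_mul]
  ring

lemma testing_identity {d : ℕ} (μ : Measure (Fin d → ℝ)) [IsLocallyFiniteMeasure μ]
    (p : ℝ≥0∞) [Fact (1 ≤ p)] (b : (Fin d → ℝ) → ℝ)
    (hb : ∀ (k : ℤ) (m : Fin d → ℤ), IntegrableOn b (dCube d k m) μ)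
    (T : Lp ℝ p μ →L[ℝ] Lp ℝ p μ)
    (hTP : ∀ f : Lp ℝ p μ, (T f : (Fin d → ℝ) → ℝ) =ᵐ[μ] paraproduct μ b f)
    (k0 : ℤ) (m0 : Fin d → ℤ) :
    ∃ c : ℝ, ∀ᵐ x ∂(μ.restrict (dCube d k0 m0)),
      (T (indLp μ p (k0, m0)) : (Fin d → ℝ) → ℝ) x = b x - avg μ b (dCube d k0 m0) + c := by
  have hco : ∀ q, (indLp μ p q : (Fin d → ℝ) → ℝ) =ᵐ[μ]
      (dCube d q.1 q.2).indicator (fun _ => (1 : ℝ)) := fun q => indicatorConstLp_coeFn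
  have hA : ∀ᵐ x ∂μ, ∀ q, (T (indLp μ p q) : (Fin d → ℝ) → ℝ) x =
      paraproduct μ b ((dCube d q.1 q.2).indicator (fun _ => (1 : ℝ))) x := by
    rw [ae_all_iff]
    intro q
    rw [← paraproduct_congr_ae (hco q)]
    exact hTP _
  let cf : ℤ × (Fin d → ℤ) → ℝ := fun q => μ.real (dCube d q.1 q.2)
  have hBB : ∀ᵐ x ∂μ, ∀ q r s : ℤ × (Fin d → ℤ),
      (cf r - cf s) * (T (indLp μ p q) : (Fin d → ℝ) → ℝ) x +
      (cf s - cf q) * (T (indLp μ p r) : (Fin d → ℝ) → ℝ) x +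
      (cf q - cf r) * (T (indLp μ p s) : (Fin d → ℝ) → ℝ) x =
      paraproduct μ b (fun y => (cf r - cf s) * (dCube d q.1 q.2).indicator (fun _ => (1 : ℝ)) y +
        (cf s - cf q) * (dCube d r.1 r.2).indicator (fun _ => (1 : ℝ)) y +
        (cf q - cf r) * (dCube d s.1 s.2).indicator (fun _ => (1 : ℝ)) y) x := by
    simp only [ae_all_iff]
    intro q r s
    have hlin : ∀ (A B C : ℝ) (f g h : Lp ℝ p μ),
        ((A • f + B • g + C • h : Lp ℝ p μ) : (Fin d → ℝ) → ℝ) =ᵐ[μ]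
          fun y => A * f y + B * g y + C * h y := by
      intro A B C f g h
      filter_upwards [Lp.coeFn_add (A • f + B • g) (C • h), Lp.coeFn_add (A • f) (B • g),
        Lp.coeFn_smul A f, Lp.coeFn_smul B g, Lp.coeFn_smul C h] with y h1 h2 h3 h4 h5
      simp only [Pi.add_apply, Pi.smul_apply, smul_eq_mul] at h1 h2 h3 h4 h5
      rw [h1, h2, h3, h4, h5]
    have hT1 := hTP ((cf r - cf s) • indLp μ p q + (cf s - cf q) • indLp μ p r +
      (cf q - cf r) • indLp μ p s)
    have hin := hlin (cf r - cf s) (cf s - cf q) (cf q - cf r) (indLp μ p q) (indLp μ p r)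
      (indLp μ p s)
    have hin2 : (fun y => (cf r - cf s) * (indLp μ p q : (Fin d → ℝ) → ℝ) y +
        (cf s - cf q) * (indLp μ p r : (Fin d → ℝ) → ℝ) y +
        (cf q - cf r) * (indLp μ p s : (Fin d → ℝ) → ℝ) y) =ᵐ[μ]
        (fun y => (cf r - cf s) * (dCube d q.1 q.2).indicator (fun _ => (1 : ℝ)) y +
        (cf s - cf q) * (dCube d r.1 r.2).indicator (fun _ => (1 : ℝ)) y +
        (cf q - cf r) * (dCube d s.1 s.2).indicator (fun _ => (1 : ℝ)) y) := by
      filter_upwards [hco q, hco r, hco s] with y h1 h2 h3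
      rw [h1, h2, h3]
    rw [paraproduct_congr_ae (hin.trans hin2)] at hT1
    have hout := hlin (cf r - cf s) (cf s - cf q) (cf q - cf r) (T (indLp μ p q))
      (T (indLp μ p r)) (T (indLp μ p s))
    rw [map_add, map_add, map_smul, map_smul, map_smul] at hT1
    filter_upwards [hT1, hout] with x h1 h2
    rw [← h1, h2]
  by_cases hne : (dCube d k0 m0).Nonempty
  swap
  · refine ⟨0, ?_⟩
    rw [Set.not_nonempty_iff_eq_empty.1 hne]
    simp
  obtain ⟨y, hy⟩ := hne
  refine ⟨∑' n : ℕ, (avg μ b (cubeOf d (k0 - n) y) - avg μ b (cubeOf d (k0 - (n + 1)) y)) *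
      ((μ.real (cubeOf d (k0 - (n + 1)) y))⁻¹ * μ.real (cubeOf d k0 y)), ?_⟩
  filter_upwards [ae_restrict_of_ae hA, ae_restrict_of_ae hBB, ae_restrict_of_ae (ae_cube_pos μ),
    ae_restrict_mem (measurableSet_dCube k0 m0), ae_tendsto_avg μ k0 m0 (hb k0 m0)]
    with x hxA hxB hxpos hxmem hxlim
  have hxy : ∀ k ≤ k0, cubeOf d k y = cubeOf d k x := by
    intro k hk
    rw [cubeOf_eq, cubeOf_eq, fl_mono hk ((mem_dCube.1 hy).trans (mem_dCube.1 hxmem).symm)]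
  have hQ : dCube d k0 m0 = cubeOf d k0 x := by rw [cubeOf_eq, mem_dCube.1 hxmem]
  have hm0 : m0 = fl k0 x := (mem_dCube.1 hxmem).symm
  let M : ℤ → ℝ := fun k => μ.real (cubeOf d k x)
  have hpos : ∀ k, 0 < M k := fun k =>
    ENNReal.toReal_pos (hxpos k) (measure_cubeOf_ne_top μ k x)
  have hanti : Antitone M := fun k l hkl =>
    ENNReal.toReal_mono (measure_cubeOf_ne_top μ k x) (measure_mono (cubeOf_anti hkl x))
  have hd : ∀ k, M (k + 1) = M k → dk μ b k x = 0 := fun k h => dk_eq_zero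
    ((ENNReal.toReal_eq_toReal_iff' (measure_cubeOf_ne_top μ _ x)
      (measure_cubeOf_ne_top μ _ x)).1 h)
  have h1 : ∀ n, (T (indLp μ p (n, fl n x)) : (Fin d → ℝ) → ℝ) x =
      ∑' k, dk μ b k x * ((M k)⁻¹ * M (max k n)) := by
    intro n
    rw [hxA, paraproduct_eq]
    refine tsum_congr fun k => ?_
    rw [← avg_indicator]; rfl
  have h2 := seq_summable M (fun k => dk μ b k x)
    (fun n => (T (indLp μ p (n, fl n x)) : (Fin d → ℝ) → ℝ) x) hpos hanti hd h1 (by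
      intro l m n
      have h := hxB (l, fl l x) (m, fl m x) (n, fl n x)
      refine h.trans ?_
      rw [paraproduct_eq]
      refine tsum_congr fun k => ?_
      rw [avg_comb, ← avg_indicator, ← avg_indicator, ← avg_indicator]; rfl) k0
  have h3 := seq_value M (fun k => avg μ b (cubeOf d k x)) hpos k0 (b x) h2 hxlim
  rw [hm0, h1 k0]
  refine h3.trans ?_
  congr 1
  refine tsum_congr fun n => ?_
  rw [hxy _ (by omega), hxy _ (by omega), hxy _ le_rfl]

lemma lacunary_sum (a χ : ℕ → ℝ) (ha : ∀ j, 0 < a j) (h2 : ∀ j, a (j + 1) ≤ a j / 2)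
    (hχ : ∀ j, χ j = 0 ∨ χ j = 1) (N : ℕ) :
    (∑ j ∈ Finset.range N, a j * χ j = 0) ∨
      ∃ j ∈ Finset.range N, χ j = 1 ∧ ∑ j ∈ Finset.range N, a j * χ j ≤ 2 * a j - 2 * a N := by
  induction N with
  | zero => left; simp
  | succ N ih =>
    rw [Finset.sum_range_succ]
    have h3 := h2 N
    rcases ih with h | ⟨j, hj, hj1, h⟩
    · rcases hχ N with h0 | h0
      · left; rw [h, h0]; ring
      · right
        refine ⟨N, by simp, h0, ?_⟩
        rw [h, h0]; linarith
    · right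
      refine ⟨j, by simp at hj ⊢; omega, hj1, ?_⟩
      rcases hχ N with h0 | h0 <;> rw [h0] <;> linarith [ha N]

lemma lacunary_norm {d : ℕ} (μ : Measure (Fin d → ℝ)) [IsLocallyFiniteMeasure μ]
    (p : ℝ) (hp : 1 < p) [Fact (1 ≤ ENNReal.ofReal p)] (q : ℕ → ℤ × (Fin d → ℤ)) (a : ℕ → ℝ)
    (ha : ∀ j, 0 < a j) (h2 : ∀ j, a (j + 1) ≤ a j / 2)
    (hw : ∀ j, a j ^ p * μ.real (dCube d (q j).1 (q j).2) = 1) (N : ℕ) :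
    ‖∑ j ∈ Finset.range N, a j • indLp μ (ENNReal.ofReal p) (q j)‖ ≤ 2 * (N : ℝ) ^ (1 / p) := by
  have hp0 : 0 < p := by linarith
  have hpne : ENNReal.ofReal p ≠ 0 := by simpa using hp0
  have hpt : (ENNReal.ofReal p).toReal = p := ENNReal.toReal_ofReal hp0.le
  let χ : ℕ → (Fin d → ℝ) → ℝ := fun j => (dCube d (q j).1 (q j).2).indicator (fun _ => (1 : ℝ))
  have hco : ((∑ j ∈ Finset.range N, a j • indLp μ (ENNReal.ofReal p) (q j) :
      Lp ℝ (ENNReal.ofReal p) μ) : (Fin d → ℝ) → ℝ) =ᵐ[μ]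
      fun x => ∑ j ∈ Finset.range N, a j * χ j x := by
    have h1 : ∀ᵐ x ∂μ, ∀ j, (a j • indLp μ (ENNReal.ofReal p) (q j) :
        Lp ℝ (ENNReal.ofReal p) μ) x = a j * χ j x := by
      rw [ae_all_iff]
      intro j
      have h0 : (indLp μ (ENNReal.ofReal p) (q j) : (Fin d → ℝ) → ℝ) =ᵐ[μ] χ j :=
        indicatorConstLp_coeFn
      filter_upwards [Lp.coeFn_smul (a j) (indLp μ (ENNReal.ofReal p) (q j)), h0]
        with x e1 e2
      rw [e1, Pi.smul_apply, e2, smul_eq_mul]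
    induction N with
    | zero =>
      simp only [Finset.range_zero, Finset.sum_empty]
      exact Lp.coeFn_zero _ _ _
    | succ N ih =>
      simp only [Finset.sum_range_succ]
      filter_upwards [ih, h1, Lp.coeFn_add (∑ j ∈ Finset.range N,
        a j • indLp μ (ENNReal.ofReal p) (q j)) (a N • indLp μ (ENNReal.ofReal p) (q N))]
        with x e1 e2 e3
      rw [e3, Pi.add_apply, e1, e2]
  rw [Lp.norm_def, eLpNorm_congr_ae hco, eLpNorm_eq_lintegral_rpow_enorm_toReal hpne
    ENNReal.ofReal_ne_top, hpt]
  have hle : ∫⁻ x, ‖∑ j ∈ Finset.range N, a j * χ j x‖ₑ ^ p ∂μ ≤ ENNReal.ofReal (2 ^ p * N) := by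
    calc ∫⁻ x, ‖∑ j ∈ Finset.range N, a j * χ j x‖ₑ ^ p ∂μ
        ≤ ∫⁻ x, ∑ j ∈ Finset.range N, (dCube d (q j).1 (q j).2).indicator
            (fun _ => ENNReal.ofReal ((2 * a j) ^ p)) x ∂μ := by
          refine lintegral_mono fun x => ?_
          rcases lacunary_sum a (fun j => χ j x) ha h2
            (fun j => by simp only [χ, Set.indicator]; split_ifs <;> simp) N with h | ⟨j, hj, hj1, h⟩
          · rw [h]; simp [hp0]
          · refine le_trans ?_ (Finset.single_le_sum (f := fun j =>
              (dCube d (q j).1 (q j).2).indicator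
                (fun _ => ENNReal.ofReal ((2 * a j) ^ p)) x) (fun _ _ => bot_le) hj)
            have hx : x ∈ dCube d (q j).1 (q j).2 := by
              by_contra hn
              simp [χ, hn] at hj1
            beta_reduce
            rw [Set.indicator_of_mem hx]
            have hnn : 0 ≤ ∑ j ∈ Finset.range N, a j * χ j x := by
              refine Finset.sum_nonneg fun i _ => mul_nonneg (ha i).le ?_
              simp only [χ, Set.indicator]; split_ifs <;> simp
            rw [Real.enorm_of_nonneg hnn, ENNReal.ofReal_rpow_of_nonneg hnn hp0.le]
            apply ENNReal.ofReal_le_ofReal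
            apply Real.rpow_le_rpow hnn _ hp0.le
            linarith [ha N]
      _ = ∑ j ∈ Finset.range N, ENNReal.ofReal ((2 * a j) ^ p) * μ (dCube d (q j).1 (q j).2) := by
          rw [lintegral_finsetSum _ (fun j _ => measurable_const.indicator
            (measurableSet_dCube _ _))]
          refine Finset.sum_congr rfl fun j _ => ?_
          rw [lintegral_indicator_const (measurableSet_dCube _ _)]
      _ = ∑ j ∈ Finset.range N, ENNReal.ofReal (2 ^ p) := by
          refine Finset.sum_congr rfl fun j _ => ?_
          rw [← ofReal_measureReal (measure_dCube_ne_top μ _ _),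
            ← ENNReal.ofReal_mul (by have := ha j; positivity),
            Real.mul_rpow (by norm_num) (ha j).le, mul_assoc, hw, mul_one]
      _ = ENNReal.ofReal (2 ^ p * N) := by
          rw [Finset.sum_const, Finset.card_range, nsmul_eq_mul, mul_comm,
            ENNReal.ofReal_mul (by positivity), ENNReal.ofReal_natCast]
  have h3 : (∫⁻ x, ‖∑ j ∈ Finset.range N, a j * χ j x‖ₑ ^ p ∂μ) ^ (1 / p) ≤
      ENNReal.ofReal (2 * (N : ℝ) ^ (1 / p)) := by
    refine (ENNReal.rpow_le_rpow hle (by positivity)).trans ?_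
    rw [ENNReal.ofReal_rpow_of_nonneg (by positivity) (by positivity),
      Real.mul_rpow (by positivity) (by positivity), ← Real.rpow_mul (by norm_num),
      mul_one_div_cancel hp0.ne', Real.rpow_one]
  exact ENNReal.toReal_le_of_le_ofReal (by positivity) h3

lemma compact_vanish {d : ℕ} (μ : Measure (Fin d → ℝ)) [IsLocallyFiniteMeasure μ]
    (p : ℝ) (hp : 1 < p) [Fact (1 ≤ ENNReal.ofReal p)]
    (T : Lp ℝ (ENNReal.ofReal p) μ →L[ℝ] Lp ℝ (ENNReal.ofReal p) μ)
    (hT : IsCompactOperator ⇑T) (ε : ℝ) (hε : 0 < ε) :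
    ∃ M : ℝ, 1 ≤ M ∧ ∀ q : ℤ × (Fin d → ℤ), M ≤ μ.real (dCube d q.1 q.2) →
      ‖T (indLp μ (ENNReal.ofReal p) q)‖ ≤ ε * μ.real (dCube d q.1 q.2) ^ (1 / p) := by
  have hp0 : 0 < p := by linarith
  have hpne : ENNReal.ofReal p ≠ 0 := by simpa using hp0
  have hpt : (ENNReal.ofReal p).toReal = p := ENNReal.toReal_ofReal hp0.le
  by_contra hcon
  push Not at hcon
  let w : ℤ × (Fin d → ℤ) → ℝ := fun q => μ.real (dCube d q.1 q.2)
  have hcon' : ∀ M : ℝ, ∃ q : ℤ × (Fin d → ℤ), M ≤ w q ∧ 1 ≤ w q ∧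
      ε * w q ^ (1 / p) < ‖T (indLp μ (ENNReal.ofReal p) q)‖ := by
    intro M
    obtain ⟨q, h1, h2⟩ := hcon (max M 1) (le_max_right _ _)
    exact ⟨q, (le_max_left _ _).trans h1, (le_max_right _ _).trans h1, h2⟩
  choose Q hQ1 hQ2 hQ3 using hcon'
  let q : ℕ → ℤ × (Fin d → ℤ) := fun n => Nat.rec (Q 1) (fun _ r => Q (2 ^ p * w r)) n
  have hq1 : ∀ n, 1 ≤ w (q n) := by
    intro n; cases n <;> exact hQ2 _
  have hq3 : ∀ n, ε * w (q n) ^ (1 / p) < ‖T (indLp μ (ENNReal.ofReal p) (q n))‖ := by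
    intro n; cases n <;> exact hQ3 _
  have hqs : ∀ n, 2 ^ p * w (q n) ≤ w (q (n + 1)) := fun n => hQ1 _
  let a : ℕ → ℝ := fun n => (w (q n) ^ (1 / p))⁻¹
  have hwp : ∀ n, 0 < w (q n) ^ (1 / p) := fun n =>
    Real.rpow_pos_of_pos (by linarith [hq1 n]) _
  have ha : ∀ n, 0 < a n := fun n => inv_pos.2 (hwp n)
  have ha2 : ∀ n, a (n + 1) ≤ a n / 2 := by
    intro n
    have h1 : 2 * w (q n) ^ (1 / p) ≤ w (q (n + 1)) ^ (1 / p) := by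
      have h := Real.rpow_le_rpow (by have := hq1 n; positivity) (hqs n)
        (by positivity : 0 ≤ 1 / p)
      rwa [Real.mul_rpow (by positivity) (by linarith [hq1 n]), ← Real.rpow_mul (by norm_num),
        mul_one_div_cancel hp0.ne', Real.rpow_one] at h
    have h2 := inv_anti₀ (by have := hwp n; positivity) h1
    rw [mul_inv] at h2
    simp only [a]
    linarith
  have hw : ∀ n, a n ^ p * w (q n) = 1 := by
    intro n
    have h0 : 0 < w (q n) := by linarith [hq1 n]
    simp only [a]
    rw [Real.inv_rpow (hwp n).le, ← Real.rpow_mul h0.le, one_div_mul_cancel hp0.ne',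
      Real.rpow_one, inv_mul_cancel₀ h0.ne']
  let f : ℕ → Lp ℝ (ENNReal.ofReal p) μ := fun n => a n • indLp μ (ENNReal.ofReal p) (q n)
  have hf1 : ∀ n, ‖f n‖ = 1 := by
    intro n
    simp only [f, indLp]
    rw [norm_smul, norm_indicatorConstLp hpne ENNReal.ofReal_ne_top, hpt, norm_one, one_mul,
      Real.norm_of_nonneg (ha n).le]
    exact inv_mul_cancel₀ (hwp n).ne'
  have hTf : ∀ n, ε ≤ ‖T (f n)‖ := by
    intro n
    simp only [f]
    rw [map_smul, norm_smul, Real.norm_of_nonneg (ha n).le]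
    have h := mul_le_mul_of_nonneg_left (hq3 n).le (ha n).le
    refine le_trans (le_of_eq ?_) h
    simp only [a]
    rw [mul_comm ε, ← mul_assoc, inv_mul_cancel₀ (hwp n).ne', one_mul]
  obtain ⟨K, hK, hKs⟩ := IsCompactOperator.image_closedBall_subset_compact
    (f := (T : Lp ℝ (ENNReal.ofReal p) μ →ₗ[ℝ] Lp ℝ (ENNReal.ofReal p) μ)) hT 1
  obtain ⟨h, -, φ, hφ, hlim⟩ := hK.tendsto_subseq (x := fun n => T (f n))
    (fun n => hKs ⟨f n, by simp [hf1 n], rfl⟩)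
  have hh : ε ≤ ‖h‖ := ge_of_tendsto' hlim.norm fun n => hTf _
  obtain ⟨j1, hj1⟩ := (Metric.tendsto_atTop.1 hlim) (ε / 2) (by linarith)
  let ψ : ℕ → ℕ := fun j => φ (j + j1)
  have haanti : Antitone a := antitone_nat_of_succ_le fun n => by linarith [ha2 n, ha n]
  have hψ2 : ∀ j, a (ψ (j + 1)) ≤ a (ψ j) / 2 := by
    intro j
    have : ψ j + 1 ≤ ψ (j + 1) := hφ (by omega)
    exact (haanti this).trans (ha2 _)
  have hup := lacunary_norm μ p hp (fun j => q (ψ j)) (fun j => a (ψ j)) (fun j => ha _) hψ2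
    (fun j => hw _)
  have hlow : ∀ N : ℕ, N * (ε / 2) ≤ ‖T (∑ j ∈ Finset.range N, f (ψ j))‖ := by
    intro N
    have e : (N : ℝ) • h = T (∑ j ∈ Finset.range N, f (ψ j)) -
        ∑ j ∈ Finset.range N, (T (f (ψ j)) - h) := by
      rw [map_sum, Finset.sum_sub_distrib, Finset.sum_const, Finset.card_range, sub_sub_cancel,
        Nat.cast_smul_eq_nsmul]
    have h1 : ‖∑ j ∈ Finset.range N, (T (f (ψ j)) - h)‖ ≤ N * (ε / 2) := by
      refine (norm_sum_le_of_le _ (fun j _ => ?_)).trans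
        (by rw [Finset.sum_const, Finset.card_range, nsmul_eq_mul])
      have := hj1 (j + j1) (by omega)
      rw [dist_eq_norm] at this
      exact this.le
    have h2 : N * ε ≤ ‖(N : ℝ) • h‖ := by
      rw [norm_smul, Real.norm_of_nonneg (Nat.cast_nonneg N)]
      exact mul_le_mul_of_nonneg_left hh (Nat.cast_nonneg N)
    rw [e] at h2
    have h3 := norm_sub_le (T (∑ j ∈ Finset.range N, f (ψ j)))
      (∑ j ∈ Finset.range N, (T (f (ψ j)) - h))
    linarith
  have hfin : ∀ N : ℕ, 0 < N → (N : ℝ) ^ (1 - 1 / p) ≤ 4 * ‖T‖ / ε := by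
    intro N hN
    have hN' : (0 : ℝ) < N := by exact_mod_cast hN
    have h1 := (hlow N).trans ((T.le_opNorm _).trans
      (mul_le_mul_of_nonneg_left (hup N) (norm_nonneg T)))
    have h2 : (N : ℝ) = N ^ (1 - 1 / p) * N ^ (1 / p) := by
      rw [← Real.rpow_add hN', sub_add_cancel, Real.rpow_one]
    have h3 : (0 : ℝ) < N ^ (1 / p) := Real.rpow_pos_of_pos hN' _
    rw [le_div_iff₀ hε]
    have h4 : ((N : ℝ) ^ (1 - 1 / p) * ε) * N ^ (1 / p) ≤ (4 * ‖T‖) * N ^ (1 / p) := by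
      calc ((N : ℝ) ^ (1 - 1 / p) * ε) * N ^ (1 / p) = 2 * (N * (ε / 2)) := by
            conv_rhs => rw [h2]
            ring
        _ ≤ 2 * (‖T‖ * (2 * N ^ (1 / p))) := by linarith
        _ = _ := by ring
    exact le_of_mul_le_mul_right h4 h3
  have hexp : 0 < 1 - 1 / p := by
    rw [sub_pos, div_lt_one hp0]; exact hp
  have htop := (tendsto_rpow_atTop hexp).comp tendsto_natCast_atTop_atTop
  obtain ⟨N, hN, hN0⟩ := ((htop.eventually_gt_atTop (4 * ‖T‖ / ε)).and
    (eventually_gt_atTop 0)).exists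
  exact absurd (hfin N hN0) (not_le.2 hN)

/-- Necessity of vanishing mean oscillation along heavy cubes for the
compactness of the dyadic paraproduct on `L^p(μ)`. -/
theorem stmt10 {d : ℕ} (μ : Measure (Fin d → ℝ)) [IsLocallyFiniteMeasure μ]
    (p : ℝ) (hp : 1 < p) [Fact (1 ≤ ENNReal.ofReal p)] (b : (Fin d → ℝ) → ℝ)
    (hb : ∀ (k : ℤ) (m : Fin d → ℤ), IntegrableOn b (dCube d k m) μ)
    (T : Lp ℝ (ENNReal.ofReal p) μ →L[ℝ] Lp ℝ (ENNReal.ofReal p) μ)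
    (hT : IsCompactOperator ⇑T)
    (hTP : ∀ f : Lp ℝ (ENNReal.ofReal p) μ, (T f : (Fin d → ℝ) → ℝ) =ᵐ[μ]
      paraproduct μ b f) :
    ∀ ε : ℝ, 0 < ε → ∃ M : ℝ, ∀ (k : ℤ) (m : Fin d → ℤ),
      ENNReal.ofReal M ≤ μ (dCube d k m) →
      ((μ (dCube d k m))⁻¹ *
          ∫⁻ x in dCube d k m,
            ENNReal.ofReal |b x - avg μ b (dCube d k m)| ^ p ∂μ) ^ (1 / p) ≤
        ENNReal.ofReal ε := by

  intro ε hε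
  have hp0 : 0 < p := by linarith
  have hpne : ENNReal.ofReal p ≠ 0 := by simpa using hp0
  have hpt : (ENNReal.ofReal p).toReal = p := ENNReal.toReal_ofReal hp0.le
  obtain ⟨M, hM1, hM⟩ := compact_vanish μ p hp T hT (ε / 2) (by linarith)
  refine ⟨M, fun k m hkm => ?_⟩
  have hfin := measure_dCube_ne_top μ k m
  set W := μ (dCube d k m) with hW
  have hMw : M ≤ μ.real (dCube d k m) := (ENNReal.ofReal_le_iff_le_toReal hfin).1 hkm
  have hW0 : W ≠ 0 := by
    intro h0
    rw [Measure.real, ← hW, h0, ENNReal.toReal_zero] at hMw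
    linarith
  have hnorm := hM (k, m) hMw
  obtain ⟨c, hc⟩ := testing_identity μ (ENNReal.ofReal p) b hb T hTP k m
  set f := T (indLp μ (ENNReal.ofReal p) (k, m)) with hf
  set ν := μ.restrict (dCube d k m) with hν
  have hνu : ν Set.univ = W := by rw [hν, Measure.restrict_apply_univ]
  have : IsFiniteMeasure ν := ⟨by rw [hνu]; exact hfin.lt_top⟩
  set β := avg μ b (dCube d k m) with hβ
  have hfp : eLpNorm f (ENNReal.ofReal p) ν ≤ ENNReal.ofReal (ε / 2) * W ^ (1 / p) := by
    refine (eLpNorm_mono_measure _ Measure.restrict_le_self).trans ?_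
    rw [← ENNReal.ofReal_toReal (Lp.eLpNorm_ne_top f), ← Lp.norm_def]
    refine (ENNReal.ofReal_le_ofReal hnorm).trans (le_of_eq ?_)
    rw [ENNReal.ofReal_mul (by linarith), ← ENNReal.ofReal_rpow_of_nonneg measureReal_nonneg
      (by positivity), ofReal_measureReal hfin]
  have hfm : AEStronglyMeasurable f ν := (Lp.aestronglyMeasurable f).restrict
  have hbi : Integrable b ν := hb k m
  have hu0 : ∫ x, (b x - β + c) ∂ν = c * W.toReal := by
    have h1 : Integrable (fun x => b x - β) ν := hbi.sub (integrable_const β)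
    rw [integral_add h1 (integrable_const c), integral_sub hbi (integrable_const β),
      integral_const, integral_const, Measure.real, hνu, hβ, avg, ← hν, ← hW]
    have : W.toReal ≠ 0 := ENNReal.toReal_ne_zero.2 ⟨hW0, hfin⟩
    simp only [smul_eq_mul]
    field_simp
    ring
  have hcW : ENNReal.ofReal |c| ≤ ENNReal.ofReal (ε / 2) := by
    have h1 : ENNReal.ofReal |c| * W = ‖∫ x, f x ∂ν‖ₑ := by
      rw [integral_congr_ae hc, hu0, enorm_mul, Real.enorm_eq_ofReal_abs,
        Real.enorm_of_nonneg ENNReal.toReal_nonneg, ENNReal.ofReal_toReal hfin]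
    have h2 : ENNReal.ofReal |c| * W ≤ ENNReal.ofReal (ε / 2) * W := by
      rw [h1]
      refine (enorm_integral_le_lintegral_enorm _).trans ?_
      rw [← eLpNorm_one_eq_lintegral_enorm]
      refine (eLpNorm_le_eLpNorm_mul_rpow_measure_univ (q := ENNReal.ofReal p) Fact.out hfm).trans ?_
      rw [hνu, hpt, ENNReal.toReal_one]
      refine (mul_le_mul_left hfp _).trans (le_of_eq ?_)
      rw [mul_assoc, ← ENNReal.rpow_add _ _ hW0 hfin]
      norm_num
    exact (ENNReal.mul_le_mul_iff_left hW0 hfin).1 h2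
  have hu : eLpNorm (fun x => b x - β) (ENNReal.ofReal p) ν ≤ ENNReal.ofReal ε * W ^ (1 / p) := by
    have hae : (fun x => b x - β) =ᵐ[ν] (f : (Fin d → ℝ) → ℝ) - fun _ => c := by
      filter_upwards [hc] with x hx
      rw [Pi.sub_apply, hx]; ring
    rw [eLpNorm_congr_ae hae]
    refine (eLpNorm_sub_le hfm aestronglyMeasurable_const Fact.out).trans ?_
    rw [eLpNorm_const' c hpne ENNReal.ofReal_ne_top, hνu, hpt, Real.enorm_eq_ofReal_abs]
    refine (add_le_add hfp (mul_le_mul_left hcW _)).trans (le_of_eq ?_)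
    rw [← add_mul, ← ENNReal.ofReal_add (by linarith) (by linarith), add_halves]
  rw [eLpNorm_eq_lintegral_rpow_enorm_toReal hpne ENNReal.ofReal_ne_top, hpt] at hu
  simp only [Real.enorm_eq_ofReal_abs] at hu
  rw [ENNReal.mul_rpow_of_nonneg _ _ (by positivity)]
  refine (mul_le_mul_right hu _).trans (le_of_eq ?_)
  rw [mul_left_comm, ← ENNReal.mul_rpow_of_nonneg _ _ (by positivity),
    ENNReal.inv_mul_cancel hW0 hfin, ENNReal.one_rpow, mul_one]
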